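/- Let n ≥ 3, let k = F_{n+1} − 1, and let 1 ≤ ℓ ≤ k−1 satisfy F_{n−1} ≤ k−ℓ ≤ F_n. Index the k+1 = F_{n+1} distinct factors of length k of the infinite Fibonacci word f by v_j = f[j;k] for 1 ≤ j ≤ F_n and v_j = f[j + F_{n+1} − (k+1); k] for F_n+1 ≤ j ≤ k+1. Then the arcs of the ℓ-Rauzy graph ℓ-R_f(k) are exactly: v_i → v_{i+(k−ℓ)} for 1 ≤ i ≤ F_{n+1} − (k−ℓ); v_i → v_{i+(k−ℓ)−F_{n+1}} for F_{n+1} − (k−ℓ) + 1 ≤ i ≤ F_{n+1}; and v_i → v_{i+(k−ℓ)−F_n} for F_n − (k−ℓ) + 1 ≤ i ≤ F_n; in particular the total number of arcs is (F_{n+1} − (k−ℓ)) + (k−ℓ) + (k−ℓ) = 2k − ℓ + 1. -/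

import Mathlib

noncomputable section

/-- τ = (√5 − 1)/2. -/
def tau : ℝ := (Real.sqrt 5 - 1) / 2

/-- The infinite Fibonacci word: the n-th letter (n ≥ 1) is 1 if ⌊(n+1)τ⌋ = ⌊nτ⌋ and 0 otherwise. -/
def fibWord (n : ℕ) : ℕ :=
  if ⌊((n : ℝ) + 1) * tau⌋ = ⌊(n : ℝ) * tau⌋ then 1 else 0

/-- f[i;k] : the factor f_i f_{i+1} ⋯ f_{i+k-1}. -/
def fibFactor (i k : ℕ) : List ℕ :=
  (List.range k).map fun j => fibWord (i + j)

/-- L_f(k) : the set of factors of the infinite Fibonacci word of length k. -/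
def fibFactors (k : ℕ) : Set (List ℕ) :=
  { x | ∃ i, 1 ≤ i ∧ x = fibFactor i k }

/-- (u,v) is an arc of the ℓ-Rauzy graph ℓ-R_f(k): u,v are vertices,
the suffix of u of length ℓ equals the prefix of v of length ℓ, and
u₁⋯u_k v_{ℓ+1}⋯v_k ∈ L_f(2k−ℓ). -/
def lArc (k l : ℕ) (u v : List ℕ) : Prop :=
  u ∈ fibFactors k ∧ v ∈ fibFactors k ∧
    u.drop (k - l) = v.take l ∧ (u ++ v.drop l) ∈ fibFactors (2 * k - l)

/-- Fibonacci numbers: F₀ = F₁ = 1, F_{n} = F_{n−1} + F_{n−2}. -/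
def fibF : ℕ → ℕ
  | 0 => 1
  | 1 => 1
  | n + 2 => fibF (n + 1) + fibF n

/-- The indexing v_j of the k+1 factors of length k of f (F_n ≤ k ≤ F_{n+1}):
v_j = f[j;k] for 1 ≤ j ≤ F_n and v_j = f[j + F_{n+1} − (k+1); k] for F_n+1 ≤ j ≤ k+1. -/
def vfac (n k j : ℕ) : List ℕ :=
  if j ≤ fibF n then fibFactor j k else fibFactor (j + fibF (n + 1) - (k + 1)) k

lemma tau_sq : tau * tau = 1 - tau := by
  have h : Real.sqrt 5 * Real.sqrt 5 = 5 := Real.mul_self_sqrt (by norm_num)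
  unfold tau
  linarith

lemma half_lt_tau : 1 / 2 < tau := by
  have h : 2 < Real.sqrt 5 := by
    rw [Real.lt_sqrt] <;> norm_num
  unfold tau
  linarith

lemma tau_lt_one : tau < 1 := by
  nlinarith [tau_sq, half_lt_tau]

lemma irrational_tau : Irrational tau := by
  have h : Irrational (Real.sqrt 5) := by
    simpa using Nat.Prime.irrational_sqrt (p := 5) (by norm_num)
  have h2 := (h.sub_intCast 1).div_natCast (m := 2) (by norm_num)
  simpa [tau] using h2

lemma intCast_mul_tau_ne {j : ℤ} (hj : j ≠ 0) (q : ℤ) : (j : ℝ) * tau ≠ q :=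
  (irrational_tau.intCast_mul hj).ne_int q

/-! ### Factors as lists -/

lemma length_fibFactor (i k : ℕ) : (fibFactor i k).length = k := by
  simp [fibFactor]

lemma fibFactor_add (i a b : ℕ) :
    fibFactor i (a + b) = fibFactor i a ++ fibFactor (i + a) b := by
  simp [fibFactor, List.range_add, Function.comp_def, add_assoc]

lemma fibFactor_eq_iff {i j k : ℕ} :
    fibFactor i k = fibFactor j k ↔ ∀ r < k, fibWord (i + r) = fibWord (j + r) := by
  simp [fibFactor, List.map_inj_left]

lemma lArc_iff {k l : ℕ} (hl : l ≤ k) (u v : List ℕ) :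
    lArc k l u v ↔
      ∃ i, 1 ≤ i ∧ u = fibFactor i k ∧ v = fibFactor (i + (k - l)) k := by
  obtain ⟨d, rfl⟩ := Nat.exists_eq_add_of_le hl
  have e1 : l + d - l = d := by omega
  have e2 : 2 * (l + d) - l = (l + d) + d := by omega
  have split_u (i : ℕ) :
      fibFactor i (l + d) = fibFactor i d ++ fibFactor (i + d) l := by
    rw [add_comm l d, fibFactor_add]
  have split_v (i : ℕ) : fibFactor (i + d) (l + d) =
      fibFactor (i + d) l ++ fibFactor (i + (l + d)) d := by
    rw [fibFactor_add]
    congr 2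
    omega
  unfold lArc
  rw [e1, e2]
  constructor
  · rintro ⟨⟨a, -, rfl⟩, -, hov, i, hi, hw⟩
    rw [fibFactor_add i (l + d) d] at hw
    obtain ⟨hu, hv⟩ := List.append_inj hw (by simp [length_fibFactor])
    refine ⟨i, hi, hu, ?_⟩
    rw [← List.take_append_drop l v, ← hov, hv, hu, split_v, split_u,
      List.drop_left' (length_fibFactor _ _)]
  · rintro ⟨i, hi, rfl, rfl⟩
    refine ⟨⟨i, hi, rfl⟩, ⟨i + d, by omega, rfl⟩, ?_, i, hi, ?_⟩
    · rw [split_u, split_v, List.drop_left' (length_fibFactor _ _),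
        List.take_left' (length_fibFactor _ _)]
    · rw [split_v, List.drop_left' (length_fibFactor _ _), ← fibFactor_add]

/-! ### Letters and floors -/

/-- Translating the argument by `p` changes floors by a constant as soon as the signs of
`x - q` are preserved. -/
lemma floor_eq_add_of_iff {x y : ℝ} {P : ℤ}
    (h : ∀ q : ℤ, (q : ℝ) ≤ x ↔ ((q + P : ℤ) : ℝ) ≤ y) : ⌊y⌋ = ⌊x⌋ + P := by
  apply le_antisymm
  · have := (h (⌊y⌋ - P)).2 (by simpa using Int.floor_le y)
    have := Int.le_floor.2 this
    omega
  · exact Int.le_floor.2 ((h ⌊x⌋).1 (Int.floor_le x))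

lemma fibWord_eq_of_floor {i j : ℕ} {P : ℤ}
    (h0 : ⌊(i : ℝ) * tau⌋ = ⌊(j : ℝ) * tau⌋ + P)
    (h1 : ⌊((i : ℝ) + 1) * tau⌋ = ⌊((j : ℝ) + 1) * tau⌋ + P) :
    fibWord i = fibWord j := by
  unfold fibWord
  rw [h0, h1]
  simp

lemma floor_succ_mul_tau (i : ℕ) :
    ⌊((i : ℝ) + 1) * tau⌋ = ⌊(i : ℝ) * tau⌋ + 1 - fibWord i := by
  have ht := half_lt_tau
  have ht' := tau_lt_one
  have h1 : ⌊(i : ℝ) * tau⌋ ≤ ⌊((i : ℝ) + 1) * tau⌋ := Int.floor_mono (by linarith)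
  have h2 : ⌊((i : ℝ) + 1) * tau⌋ ≤ ⌊(i : ℝ) * tau⌋ + 1 := by
    rw [← Int.floor_add_one]
    exact Int.floor_mono (by linarith)
  unfold fibWord
  split_ifs with h
  · simp [h]
  · push_cast
    omega

/-- Equality of factors makes the difference of the floors constant along them. -/
lemma floor_add_eq_of_fibFactor_eq {i j k : ℕ} (h : fibFactor i k = fibFactor j k)
    {r : ℕ} (hr : r ≤ k) :
    ⌊((j + r : ℕ) : ℝ) * tau⌋ =
      ⌊((i + r : ℕ) : ℝ) * tau⌋ + (⌊(j : ℝ) * tau⌋ - ⌊(i : ℝ) * tau⌋) := by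
  induction r with
  | zero => simp
  | succ r ih =>
    have hl := fibFactor_eq_iff.1 h r (by omega)
    have hi := floor_succ_mul_tau (i + r)
    have hj := floor_succ_mul_tau (j + r)
    have := ih (by omega)
    simp only [← add_assoc]
    push_cast at *
    rw [hi, hj, this, hl]
    ring

/-! ### Consecutive Fibonacci numbers -/

/-- `B` and `C` are consecutive Fibonacci numbers, in the sense of the approximation properties
of `C / B` with respect to `τ`; `ε` is the scaled error. -/
structure ConsecFib (B C : ℕ) (ε : ℝ) : Prop where
  pos_left : 0 < B
  pos_right : 0 < C
  det : ((B : ℤ) * (B - C) - C * C) ^ 2 = 1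
  ne_zero : ε ≠ 0
  approx : (B : ℝ) * tau - C = tau * ε

lemma fibF_pos (n : ℕ) : 0 < fibF n := by
  induction n using fibF.induct with
  | case1 => simp [fibF]
  | case2 => simp [fibF]
  | case3 n h1 h2 => rw [fibF]; omega

lemma consecFib_fibF (n : ℕ) : ConsecFib (fibF (n + 1)) (fibF n) ((-tau) ^ (n + 1)) := by
  have ht := half_lt_tau
  refine ⟨fibF_pos _, fibF_pos _, ?_, pow_ne_zero _ (by linarith), ?_⟩
  · induction n with
    | zero => simp [fibF]
    | succ n ih =>
      rw [fibF]
      push_cast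
      rw [← ih]
      ring
  · induction n with
    | zero => simp only [fibF, zero_add, pow_one]; push_cast; linarith [tau_sq]
    | succ n ih =>
      rw [fibF, pow_succ]
      push_cast
      linear_combination (-tau) * ih + (fibF (n + 1) : ℝ) * tau_sq

/-! ### Block decomposition -/

/-- The number of letters `0` among the first `m` letters. -/
def fibZeros (m : ℕ) : ℕ := ⌊((m : ℝ) + 1) * tau⌋₊

lemma fibZeros_spec (m : ℕ) :
    -tau < (m : ℝ) * tau - fibZeros m ∧ (m : ℝ) * tau - fibZeros m < 1 - tau := by
  have ht := half_lt_tau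
  have h0 : 0 ≤ ((m : ℝ) + 1) * tau := by positivity
  have h1 : (fibZeros m : ℝ) ≤ ((m : ℝ) + 1) * tau := Nat.floor_le h0
  have h2 : ((m : ℝ) + 1) * tau < fibZeros m + 1 := Nat.lt_floor_add_one _
  have h3 : ((m : ℝ) + 1) * tau ≠ fibZeros m := by
    have := intCast_mul_tau_ne (j := m + 1) (by omega) (fibZeros m)
    push_cast at this
    exact this
  have h4 := lt_of_le_of_ne h1 (Ne.symm h3)
  constructor <;> linarith

lemma fibZeros_succ (m : ℕ) :
    fibZeros (m + 1) = fibZeros m ∨ fibZeros (m + 1) = fibZeros m + 1 := by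
  have ht := half_lt_tau
  have ht' := tau_lt_one
  obtain ⟨h1, h2⟩ := fibZeros_spec m
  obtain ⟨h3, h4⟩ := fibZeros_spec (m + 1)
  push_cast at h3 h4
  have h5 : fibZeros m < fibZeros (m + 1) + 1 := by
    have : (fibZeros m : ℝ) < fibZeros (m + 1) + 1 := by linarith
    exact_mod_cast this
  have h6 : fibZeros (m + 1) < fibZeros m + 2 := by
    have : (fibZeros (m + 1) : ℝ) < fibZeros m + 2 := by linarith
    exact_mod_cast this
  omega

lemma fibZeros_eq {m z : ℕ} (h1 : (z : ℝ) ≤ ((m : ℝ) + 1) * tau)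
    (h2 : ((m : ℝ) + 1) * tau < z + 1) : fibZeros m = z :=
  (Nat.floor_eq_iff (le_trans (Nat.cast_nonneg z) h1)).2 ⟨h1, h2⟩

/-- The position before the `m`-th block, in the decomposition of the Fibonacci word into
blocks of lengths `B + C` and `B`. -/
def blockStart (B C m : ℕ) : ℕ := B * m + C * fibZeros m

lemma blockStart_zero (B C : ℕ) : blockStart B C 0 = 0 := by
  have : fibZeros 0 = 0 := fibZeros_eq
    (by have := half_lt_tau; push_cast; linarith) (by have := tau_lt_one; push_cast; linarith)
  simp [blockStart, this]

lemma blockStart_one (B C : ℕ) : blockStart B C 1 = B + C := by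
  have : fibZeros 1 = 1 := fibZeros_eq
    (by have := half_lt_tau; push_cast; linarith) (by have := tau_lt_one; push_cast; linarith)
  simp [blockStart, this]

lemma blockStart_two (B C : ℕ) : blockStart B C 2 = B + C + B := by
  have ht := half_lt_tau
  have : fibZeros 2 = 1 := fibZeros_eq
    (by push_cast; linarith) (by push_cast; nlinarith [tau_sq])
  simp [blockStart, this]
  ring

lemma blockStart_succ (B C m : ℕ) :
    blockStart B C (m + 1) = blockStart B C m + B ∨
      blockStart B C (m + 1) = blockStart B C m + (B + C) := by
  unfold blockStart
  rcases fibZeros_succ m with h | h <;> rw [h]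
  · left; ring
  · right; ring

/-! ### Positions of arcs -/

/-- The pairs of positions of the arcs with shift `d`. -/
def arcPositions (A B d : ℕ) : Finset (ℕ × ℕ) :=
  (Finset.Icc 1 (A - d)).image (fun i => (i, i + d)) ∪
    (Finset.Icc (A - d + 1) A).image (fun i => (i, i + d - A)) ∪
    (Finset.Icc (B - d + 1) B).image (fun i => (i, i + d - B))

lemma mem_arcPositions {A B d x y : ℕ} : (x, y) ∈ arcPositions A B d ↔
    (1 ≤ x ∧ x ≤ A - d ∧ y = x + d) ∨ (A - d + 1 ≤ x ∧ x ≤ A ∧ y = x + d - A) ∨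
      (B - d + 1 ≤ x ∧ x ≤ B ∧ y = x + d - B) := by
  simp only [arcPositions, Finset.mem_union, Finset.mem_image, Finset.mem_Icc, Prod.mk.injEq]
  constructor
  · rintro ((⟨i, hi, rfl, rfl⟩ | ⟨i, hi, rfl, rfl⟩) | ⟨i, hi, rfl, rfl⟩) <;> omega
  · rintro (h | h | h)
    · exact Or.inl (Or.inl ⟨x, by omega, rfl, by omega⟩)
    · exact Or.inl (Or.inr ⟨x, by omega, rfl, by omega⟩)
    · exact Or.inr ⟨x, by omega, rfl, by omega⟩

lemma card_arcPositions {A B d : ℕ} (hB : 0 < B) (hBA : B < A) (hd : d ≤ B) :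
    (arcPositions A B d).card = A + d := by
  have inj (s : Finset ℕ) (g : ℕ → ℕ) : (s.image fun i => (i, g i)).card = s.card :=
    Finset.card_image_of_injective _ fun _ _ h => (Prod.mk.inj h).1
  unfold arcPositions
  rw [Finset.card_union_of_disjoint, Finset.card_union_of_disjoint, inj, inj, inj]
  · simp only [Nat.card_Icc]
    omega
  · rw [Finset.disjoint_left]
    rintro ⟨x, y⟩ h1 h2
    simp only [Finset.mem_image, Finset.mem_Icc, Prod.mk.injEq] at h1 h2
    omega
  · rw [Finset.disjoint_left]
    rintro ⟨x, y⟩ h1 h2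
    simp only [Finset.mem_union, Finset.mem_image, Finset.mem_Icc, Prod.mk.injEq] at h1 h2
    omega

namespace ConsecFib

variable {B C : ℕ} {ε : ℝ}

lemma approx_right (h : ConsecFib B C ε) : (C : ℝ) * tau - (B - C) = -ε := by
  have ht := half_lt_tau
  have h0 : tau ≠ 0 := by linarith
  apply mul_left_cancel₀ h0
  linear_combination (-1) * h.approx + (C : ℝ) * tau_sq

/-- Coordinates of an integer vector in the basis `(B, C)`, `(C, B - C)`. -/
lemma exists_coord (h : ConsecFib B C ε) (j P : ℤ) :
    ∃ a b : ℤ, j = a * B + b * C ∧ P = a * C + b * (B - C) ∧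
      (j : ℝ) * tau - P = ε * (a * tau - b) := by
  obtain ⟨s, hs⟩ : ∃ s : ℤ, s = (B : ℤ) * (B - C) - C * C := ⟨_, rfl⟩
  have hs2 : s * s = 1 := by rw [hs, ← sq]; exact h.det
  have hj : j = s * (j * (B - C) - P * C) * B + s * (P * B - j * C) * C := by
    linear_combination (-j) * hs2 + j * s * hs
  have hP : P = s * (j * (B - C) - P * C) * C + s * (P * B - j * C) * (B - C) := by
    linear_combination (-P) * hs2 + P * s * hs
  refine ⟨_, _, hj, hP, ?_⟩
  generalize s * (j * (B - C) - P * C) = a at hj hP ⊢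
  generalize s * (P * B - j * C) = b at hj hP ⊢
  rw [hj, hP]
  push_cast
  linear_combination (a : ℝ) * h.approx + (b : ℝ) * h.approx_right

lemma coord_ge_tau {a b : ℤ} (h : ConsecFib B C ε) (h0 : 0 < a * B + b * C)
    (h1 : a * B + b * C < 2 * B + C) (hpos : 0 < (a : ℝ) * tau - b) :
    tau ≤ (a : ℝ) * tau - b := by
  have ht := half_lt_tau
  have ht' := tau_lt_one
  have hB : (0 : ℤ) < B := by exact_mod_cast h.pos_left
  have hC : (0 : ℤ) < C := by exact_mod_cast h.pos_right
  by_contra! hlt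
  rcases lt_trichotomy b 0 with hb | rfl | hb
  · have hb' : (b : ℝ) ≤ -1 := by exact_mod_cast (by omega : b ≤ -1)
    have ha : a ≤ 0 := by
      by_contra! ha
      have : (1 : ℝ) ≤ a := by exact_mod_cast ha
      nlinarith
    nlinarith
  · have ha : 0 < a := by
      have : (0 : ℝ) < a := by
        by_contra! hc
        push_cast at hpos
        nlinarith
      exact_mod_cast this
    have : (1 : ℝ) ≤ a := by exact_mod_cast ha
    push_cast at hlt
    nlinarith
  · have hb' : (1 : ℝ) ≤ b := by exact_mod_cast hb
    have ha : 2 ≤ a := by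
      by_contra! ha
      have : (a : ℝ) ≤ 1 := by exact_mod_cast (by omega : a ≤ 1)
      nlinarith
    nlinarith

lemma coord_le_neg {a b : ℤ} (h : ConsecFib B C ε) (h0 : 0 < a * B + b * C)
    (h1 : a * B + b * C < 2 * B + C) (hneg : (a : ℝ) * tau - b < 0) :
    (a : ℝ) * tau - b ≤ tau - 1 := by
  have ht := half_lt_tau
  have ht' := tau_lt_one
  have hB : (0 : ℤ) < B := by exact_mod_cast h.pos_left
  have hC : (0 : ℤ) < C := by exact_mod_cast h.pos_right
  by_contra! hlt
  rcases lt_or_ge b 1 with hb | hb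
  · have hb' : (b : ℝ) ≤ 0 := by exact_mod_cast (by omega : b ≤ 0)
    have ha : a ≤ -1 := by
      by_contra! ha
      have : (0 : ℝ) ≤ a := by exact_mod_cast (by omega : 0 ≤ a)
      nlinarith
    nlinarith
  · have hb' : (1 : ℝ) ≤ b := by exact_mod_cast hb
    have ha : 2 ≤ a := by
      by_contra! ha
      have : (a : ℝ) ≤ 1 := by exact_mod_cast (by omega : a ≤ 1)
      nlinarith
    nlinarith

lemma coord_le_neg_one {a b : ℤ} (h : ConsecFib B C ε) (h0 : 0 < a * B + b * C)
    (h1 : a * B + b * C < B + C) (hneg : (a : ℝ) * tau - b < 0) :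
    (a : ℝ) * tau - b ≤ -1 := by
  have ht := half_lt_tau
  have ht' := tau_lt_one
  have hB : (0 : ℤ) < B := by exact_mod_cast h.pos_left
  have hC : (0 : ℤ) < C := by exact_mod_cast h.pos_right
  by_contra! hlt
  rcases lt_or_ge b 1 with hb | hb
  · have hb' : (b : ℝ) ≤ 0 := by exact_mod_cast (by omega : b ≤ 0)
    have ha : a ≤ -1 := by
      by_contra! ha
      have : (0 : ℝ) ≤ a := by exact_mod_cast (by omega : 0 ≤ a)
      nlinarith
    nlinarith
  · have hb' : (1 : ℝ) ≤ b := by exact_mod_cast hb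
    have ha : 1 ≤ a := by
      by_contra! ha
      have : (a : ℝ) ≤ 0 := by exact_mod_cast (by omega : a ≤ 0)
      nlinarith
    nlinarith

/-! ### The word read from a block boundary -/

lemma floor_blockStart_add (h : ConsecFib B C ε) (m : ℕ) {j : ℕ} (h0 : 0 < j)
    (h1 : j < 2 * B + C) :
    ⌊((blockStart B C m + j : ℕ) : ℝ) * tau⌋ =
      ⌊(j : ℝ) * tau⌋ + ((C : ℤ) * m + (B - C) * fibZeros m) := by
  apply floor_eq_add_of_iff
  intro q
  obtain ⟨a, b, hj, hq, hc⟩ := h.exists_coord j q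
  have hshift : ((blockStart B C m + j : ℕ) : ℝ) * tau -
      ((q + ((C : ℤ) * m + (B - C) * fibZeros m) : ℤ) : ℝ) =
      ε * (a * tau - b + (m * tau - fibZeros m)) := by
    unfold blockStart
    push_cast at hc ⊢
    linear_combination hc + (m : ℝ) * h.approx + (fibZeros m : ℝ) * h.approx_right
  obtain ⟨ht1, ht2⟩ := fibZeros_spec m
  have hne : (a : ℝ) * tau - b ≠ 0 := by
    intro h00
    rw [h00, mul_zero] at hc
    exact intCast_mul_tau_ne (j := (j : ℤ)) (by omega) q (by linarith)
  have h0' : 0 < a * B + b * C := by omega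
  have h1' : a * B + b * C < 2 * B + C := by omega
  rw [← sub_nonneg, ← sub_nonneg (b := ((q + _ : ℤ) : ℝ)), hshift]
  push_cast at hc
  rw [hc]
  rcases lt_or_gt_of_ne hne with hneg | hpos
  · have h2 := h.coord_le_neg h0' h1' hneg
    have h3 : (a : ℝ) * tau - b + (m * tau - fibZeros m) < 0 := by linarith
    rcases lt_or_gt_of_ne h.ne_zero with he | he
    · exact iff_of_true (mul_pos_of_neg_of_neg he hneg).le (mul_pos_of_neg_of_neg he h3).le
    · exact iff_of_false (not_le.2 (mul_neg_of_pos_of_neg he hneg))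
        (not_le.2 (mul_neg_of_pos_of_neg he h3))
  · have h2 := h.coord_ge_tau h0' h1' hpos
    have h3 : 0 < (a : ℝ) * tau - b + (m * tau - fibZeros m) := by linarith
    rcases lt_or_gt_of_ne h.ne_zero with he | he
    · exact iff_of_false (not_le.2 (mul_neg_of_neg_of_pos he hpos))
        (not_le.2 (mul_neg_of_neg_of_pos he h3))
    · exact iff_of_true (mul_pos he hpos).le (mul_pos he h3).le

lemma fibWord_blockStart_add (h : ConsecFib B C ε) (m : ℕ) {j : ℕ} (h0 : 0 < j)
    (h1 : j + 1 < 2 * B + C) : fibWord (blockStart B C m + j) = fibWord j := by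
  refine fibWord_eq_of_floor (h.floor_blockStart_add m h0 (by omega)) ?_
  have := h.floor_blockStart_add m (j := j + 1) (by omega) h1
  rw [← add_assoc] at this
  push_cast at this ⊢
  exact this

/-- The factor at position `j` of any block depends only on `j`, for small `j`. -/
lemma fibFactor_blockStart_add (h : ConsecFib B C ε) (m : ℕ) {j : ℕ} (h0 : 0 < j)
    (h1 : j ≤ B) :
    fibFactor (blockStart B C m + j) (B + C - 1) = fibFactor j (B + C - 1) := by
  refine fibFactor_eq_iff.2 fun r hr => ?_
  rw [add_assoc]
  exact h.fibWord_blockStart_add m (by omega) (by omega)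

/-- The factor at position `j` of a long block depends only on `j`. -/
lemma fibFactor_blockStart_add_of_long (h : ConsecFib B C ε) (hB : 2 ≤ B) {m : ℕ}
    (hm : blockStart B C (m + 1) = blockStart B C m + (B + C)) {j : ℕ} (h0 : 0 < j)
    (h1 : j ≤ B + C) :
    fibFactor (blockStart B C m + j) (B + C - 1) = fibFactor j (B + C - 1) := by
  refine fibFactor_eq_iff.2 fun r hr => ?_
  rw [add_assoc]
  rcases le_or_gt (j + r) (B + C) with hle | hgt
  · exact h.fibWord_blockStart_add m (by omega) (by omega)
  · obtain ⟨s, hs⟩ := Nat.exists_eq_add_of_le hgt.le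
    have e1 := h.fibWord_blockStart_add (m + 1) (j := s) (by omega) (by omega)
    have e2 := h.fibWord_blockStart_add 1 (j := s) (by omega) (by omega)
    rw [blockStart_one] at e2
    rw [hm, add_assoc] at e1
    rw [hs, e1, e2]

lemma exists_block (h : ConsecFib B C ε) {i : ℕ} (hi : 0 < i) :
    ∃ m, blockStart B C m < i ∧ i ≤ blockStart B C (m + 1) := by
  have hB := h.pos_left
  have hlarge : ∃ m, i ≤ blockStart B C m := ⟨i, by unfold blockStart; nlinarith⟩
  have hspec := Nat.find_spec hlarge
  have hmin := fun m => Nat.find_min hlarge (m := m)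
  generalize Nat.find hlarge = M at hspec hmin
  rcases M with _ | M
  · rw [blockStart_zero] at hspec
    omega
  · exact ⟨M, not_le.1 (hmin M (by omega)), hspec⟩

/-! ### Distinctness of the factors at positions `1, …, B + C` -/

lemma fibFactor_ne (h : ConsecFib B C ε) {i i' : ℕ} (hi : 1 ≤ i) (hlt : i < i')
    (hi' : i' ≤ B + C) : fibFactor i (B + C - 1) ≠ fibFactor i' (B + C - 1) := by
  intro heq
  have ht := half_lt_tau
  have ht' := tau_lt_one
  obtain ⟨g, hg⟩ := Nat.exists_eq_add_of_le hlt.le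
  obtain ⟨P, hP⟩ : ∃ P : ℤ, P = ⌊(i' : ℝ) * tau⌋ - ⌊(i : ℝ) * tau⌋ := ⟨_, rfl⟩
  have key (N : ℕ) (hN : i ≤ N) (hN' : N ≤ i + (B + C - 1)) (q : ℤ) :
      (0 ≤ (N : ℝ) * tau - q ↔ 0 ≤ ((N : ℝ) * tau - q) + ((g : ℝ) * tau - P)) := by
    obtain ⟨r, rfl⟩ := Nat.exists_eq_add_of_le hN
    have hf := floor_add_eq_of_fibFactor_eq heq (r := r) (by omega)
    rw [← hP] at hf
    rw [sub_nonneg, ← Int.le_floor]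
    have e : ((i + r : ℕ) : ℝ) * tau - q + ((g : ℝ) * tau - P) =
        ((i' + r : ℕ) : ℝ) * tau - ((q + P : ℤ) : ℝ) := by
      rw [hg]; push_cast; ring
    rw [e, sub_nonneg, ← Int.le_floor, hf]
    omega
  obtain ⟨a, b, hj, -, hc⟩ := h.exists_coord g P
  push_cast at hc
  have happ := h.approx
  have hsum : ((B + C : ℕ) : ℝ) * tau - (B : ℤ) = ε * (tau - 1) := by
    have h0 : tau ≠ 0 := by linarith
    apply mul_left_cancel₀ h0
    push_cast
    linear_combination (tau - 1) * happ + (C + B : ℝ) * tau_sq - (B : ℝ) * tau_sq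
  have hne : (a : ℝ) * tau - b ≠ 0 := by
    intro h00
    rw [h00, mul_zero] at hc
    exact intCast_mul_tau_ne (j := (g : ℤ)) (by omega) P (by push_cast; linarith)
  have h0' : 0 < a * B + b * C := by omega
  have h1' : a * B + b * C < B + C := by omega
  -- a point whose scaled position `x` changes sign under the shift by `a τ - b`
  have contra (N : ℕ) (hN : i ≤ N) (hN' : N ≤ i + (B + C - 1)) (q : ℤ) (x : ℝ)
      (hx : (N : ℝ) * tau - q = ε * x) (hs : x * (x + (a * tau - b)) < 0) : False := by
    have hk := key N hN hN' q
    rw [hc, hx, ← mul_add] at hk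
    have he : 0 < ε * ε := mul_self_pos.2 h.ne_zero
    have hprod : (ε * x) * (ε * (x + (a * tau - b))) < 0 := by nlinarith
    rcases mul_neg_iff.1 hprod with ⟨h1, h2⟩ | ⟨h1, h2⟩
    · exact absurd (hk.1 h1.le) (not_le.2 h2)
    · exact absurd (hk.2 h2.le) (not_le.2 h1)
  rcases lt_or_gt_of_ne hne with hneg | hpos
  · have h2 := h.coord_le_neg_one h0' h1' hneg
    rcases le_or_gt i B with hiB | hiB
    · refine contra B hiB (by omega) C tau (by push_cast; linarith) ?_
      exact mul_neg_of_pos_of_neg (by linarith) (by linarith)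
    · refine contra (B + C + B) (by omega) (by omega) (B + C) (2 * tau - 1) ?_ ?_
      · push_cast at hsum ⊢
        linarith
      · exact mul_neg_of_pos_of_neg (by linarith) (by linarith)
  · have h2 := h.coord_ge_tau h0' (by omega) hpos
    refine contra (B + C) (by omega) (by omega) B (tau - 1) hsum ?_
    exact mul_neg_of_neg_of_pos (by linarith) (by linarith)

/-! ### Pairs of factors at a fixed distance -/

/-- Pairs of factors at distance `d` come exactly from the pairs in `arcPositions`. -/
lemma pairs_eq_image (h : ConsecFib B C ε) (hB : 2 ≤ B) {d : ℕ} (hd : d ≤ B) :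
    {q : List ℕ × List ℕ | ∃ i, 1 ≤ i ∧ q.1 = fibFactor i (B + C - 1) ∧
      q.2 = fibFactor (i + d) (B + C - 1)} =
    (fun p : ℕ × ℕ => (fibFactor p.1 (B + C - 1), fibFactor p.2 (B + C - 1))) ''
      (arcPositions (B + C) B d : Set (ℕ × ℕ)) := by
  have hC := h.pos_right
  ext ⟨u, v⟩
  simp only [Set.mem_ofPred_eq, Set.mem_image, Finset.mem_coe, Prod.exists, mem_arcPositions,
    Prod.mk.injEq]
  constructor
  · rintro ⟨i, hi, rfl, rfl⟩
    obtain ⟨m, hm1, hm2⟩ := h.exists_block hi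
    obtain ⟨j, rfl⟩ := Nat.exists_eq_add_of_le hm1.le
    rcases blockStart_succ B C m with hs | hs
    · refine ⟨j, if j ≤ B - d then j + d else j + d - B, ?_,
        (h.fibFactor_blockStart_add m (by omega) (by omega)).symm, ?_⟩
      · split_ifs <;> omega
      · split_ifs with hj
        · rw [add_assoc]
          exact (h.fibFactor_blockStart_add m (by omega) (by omega)).symm
        · have e : blockStart B C m + j + d = blockStart B C (m + 1) + (j + d - B) := by omega
          rw [e]
          exact (h.fibFactor_blockStart_add (m + 1) (by omega) (by omega)).symm
    · refine ⟨j, if j ≤ B + C - d then j + d else j + d - (B + C), ?_,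
        (h.fibFactor_blockStart_add_of_long hB hs (by omega) (by omega)).symm, ?_⟩
      · split_ifs <;> omega
      · split_ifs with hj
        · rw [add_assoc]
          exact (h.fibFactor_blockStart_add_of_long hB hs (by omega) (by omega)).symm
        · have e : blockStart B C m + j + d =
              blockStart B C (m + 1) + (j + d - (B + C)) := by omega
          rw [e]
          exact (h.fibFactor_blockStart_add (m + 1) (by omega) (by omega)).symm
  · rintro ⟨x, y, hxy, rfl, rfl⟩
    have h1 := blockStart_one B C
    have h2 := blockStart_two B C
    rcases hxy with ⟨hx1, hx2, rfl⟩ | ⟨hx1, hx2, rfl⟩ | ⟨hx1, hx2, rfl⟩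
    · exact ⟨x, hx1, rfl, rfl⟩
    · refine ⟨x, by omega, rfl, ?_⟩
      rw [← h.fibFactor_blockStart_add 1 (j := x + d - (B + C)) (by omega) (by omega)]
      congr 1
      omega
    · refine ⟨blockStart B C 1 + x, by omega,
        (h.fibFactor_blockStart_add 1 (by omega) hx2).symm, ?_⟩
      rw [← h.fibFactor_blockStart_add 2 (j := x + d - B) (by omega) (by omega)]
      congr 1
      omega

lemma injOn_arcPositions (h : ConsecFib B C ε) {d : ℕ} (hd : d ≤ B) :
    Set.InjOn (fun p : ℕ × ℕ => (fibFactor p.1 (B + C - 1), fibFactor p.2 (B + C - 1)))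
      (arcPositions (B + C) B d : Set (ℕ × ℕ)) := by
  have inj {x y : ℕ} (hx : 1 ≤ x) (hx' : x ≤ B + C) (hy : 1 ≤ y) (hy' : y ≤ B + C)
      (hxy : fibFactor x (B + C - 1) = fibFactor y (B + C - 1)) : x = y := by
    rcases lt_trichotomy x y with hlt | heq | hlt
    · exact absurd hxy (h.fibFactor_ne hx hlt hy')
    · exact heq
    · exact absurd hxy.symm (h.fibFactor_ne hy hlt hx')
  rintro ⟨x, y⟩ hxy ⟨x', y'⟩ hxy' heq
  rw [Finset.mem_coe, mem_arcPositions] at hxy hxy'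
  obtain ⟨e1, e2⟩ := Prod.mk.inj heq
  exact Prod.ext (inj (by omega) (by omega) (by omega) (by omega) e1)
    (inj (by omega) (by omega) (by omega) (by omega) e2)

end ConsecFib

/-- For k = F_{n+1} − 1 and F_{n−1} ≤ k−ℓ ≤ F_n, the arcs of ℓ-R_f(k) are exactly
v_i → v_{i+(k−ℓ)} for 1 ≤ i ≤ F_{n+1}−(k−ℓ), v_i → v_{i+(k−ℓ)−F_{n+1}} for
F_{n+1}−(k−ℓ)+1 ≤ i ≤ F_{n+1}, and v_i → v_{i+(k−ℓ)−F_n} for F_n−(k−ℓ)+1 ≤ i ≤ F_n;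
in particular the total number of arcs is 2k−ℓ+1. -/
theorem fib_arc_description (n k l : ℕ) (hn : 3 ≤ n) (hk : k = fibF (n + 1) - 1)
    (hl1 : 1 ≤ l) (hl2 : l ≤ k - 1)
    (h1 : fibF (n - 1) ≤ k - l) (h2 : k - l ≤ fibF n) :
    ({q : List ℕ × List ℕ | lArc k l q.1 q.2} =
      {q | ∃ i, 1 ≤ i ∧ i ≤ fibF (n + 1) - (k - l) ∧
          q = (vfac n k i, vfac n k (i + (k - l)))} ∪
      {q | ∃ i, fibF (n + 1) - (k - l) + 1 ≤ i ∧ i ≤ fibF (n + 1) ∧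
          q = (vfac n k i, vfac n k (i + (k - l) - fibF (n + 1)))} ∪
      {q | ∃ i, fibF n - (k - l) + 1 ≤ i ∧ i ≤ fibF n ∧
          q = (vfac n k i, vfac n k (i + (k - l) - fibF n))}) ∧
    {q : List ℕ × List ℕ | lArc k l q.1 q.2}.ncard = 2 * k - l + 1 := by
  obtain ⟨n, rfl⟩ : ∃ m, n = m + 1 := ⟨n - 1, by omega⟩
  have h := consecFib_fibF n
  have hA : fibF (n + 1 + 1) = fibF (n + 1) + fibF n := rfl
  have hB : 2 ≤ fibF (n + 1) := by
    obtain ⟨m, rfl⟩ : ∃ m, n = m + 1 := ⟨n - 1, by omega⟩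
    have h1 := fibF_pos m
    have h2 := fibF_pos (m + 1)
    rw [fibF]
    omega
  have hC := h.pos_right
  have hv (j : ℕ) : vfac (n + 1) k j = fibFactor j k := by
    unfold vfac
    split_ifs
    · rfl
    · congr 1
      omega
  have harcs : {q : List ℕ × List ℕ | lArc k l q.1 q.2} =
      (fun p : ℕ × ℕ => (fibFactor p.1 k, fibFactor p.2 k)) ''
        (arcPositions (fibF (n + 1) + fibF n) (fibF (n + 1)) (k - l) : Set (ℕ × ℕ)) := by
    simp only [lArc_iff (show l ≤ k by omega)]
    have := h.pairs_eq_image hB h2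
    rwa [← hA, ← hk] at this
  constructor
  · rw [harcs]
    ext ⟨u, v⟩
    simp only [hv, hA, Set.mem_image, Finset.mem_coe, Prod.exists, mem_arcPositions,
      Set.mem_union, Set.mem_ofPred_eq, Prod.mk.injEq]
    constructor
    · rintro ⟨x, y, ⟨hx1, hx2, rfl⟩ | ⟨hx1, hx2, rfl⟩ | ⟨hx1, hx2, rfl⟩, rfl, rfl⟩
      · exact Or.inl (Or.inl ⟨x, hx1, hx2, rfl, rfl⟩)
      · exact Or.inl (Or.inr ⟨x, hx1, hx2, rfl, rfl⟩)
      · exact Or.inr ⟨x, hx1, hx2, rfl, rfl⟩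
    · rintro ((⟨x, hx1, hx2, rfl, rfl⟩ | ⟨x, hx1, hx2, rfl, rfl⟩) | ⟨x, hx1, hx2, rfl, rfl⟩)
      · exact ⟨x, _, Or.inl ⟨hx1, hx2, rfl⟩, rfl, rfl⟩
      · exact ⟨x, _, Or.inr (Or.inl ⟨hx1, hx2, rfl⟩), rfl, rfl⟩
      · exact ⟨x, _, Or.inr (Or.inr ⟨hx1, hx2, rfl⟩), rfl, rfl⟩
  · have hinj := h.injOn_arcPositions h2
    rw [← hA, ← hk] at hinj
    rw [harcs, ← hA, hinj.ncard_image, Set.ncard_coe_finset,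
      card_arcPositions (by omega) (by omega) h2]
    omega
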